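/- There exist universal constants C, c > 0 such that the following holds. For all integers k, t ≥ 1, d ≥ 0, all ε ∈ (0,1), and all τ ≥ 0, there is a sample size m ≤ C·(d+1)·k·t·(log((d+1)kt/ε))^c / ε² and a learning algorithm A using m samples over [−1,1) such that: for every probability distribution p over [−1,1) that is a k-mixture of (τ,t)-piecewise degree-d distributions, with probability at least 9/10 over m i.i.d. samples drawn from p, A outputs a (2kt−1)-piecewise degree-d distribution h over [−1,1) with d_TV(p,h) ≤ 4·opt_{kt,d}(p)·(1+ε) + C·ε (note opt_{kt,d}(p) ≤ τ). (Main result, Theorem 2 / Theorem thm:main-detail, sample-complexity part.) -/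

import Mathlib

open MeasureTheory Set
open scoped ENNReal

noncomputable def tvDist (p q : Measure ℝ) : ℝ :=
  ⨆ A : {S : Set ℝ // MeasurableSet S}, |(p A.1).toReal - (q A.1).toReal|

def IsPiecewisePoly (a b : ℝ) (t d : ℕ) (f : ℝ → ℝ) : Prop :=
  ∃ x : Fin (t + 1) → ℝ, x 0 = a ∧ x (Fin.last t) = b ∧ Monotone x ∧
    ∀ i : Fin t, ∃ P : Polynomial ℝ, P.natDegree ≤ d ∧
      ∀ y ∈ Set.Ico (x i.castSucc) (x i.succ), f y = P.eval y

def IsPiecewisePolyDist (q : Measure ℝ) (a b : ℝ) (t d : ℕ) : Prop :=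
  IsProbabilityMeasure q ∧
  ∃ f : ℝ → ℝ, (∀ y ∈ Set.Ico a b, 0 ≤ f y) ∧
    q = (volume.restrict (Set.Ico a b)).withDensity (fun y => ENNReal.ofReal (f y)) ∧
    IsPiecewisePoly a b t d f

noncomputable def optTD (p : Measure ℝ) (t d : ℕ) : ℝ :=
  sInf {x : ℝ | ∃ q : Measure ℝ, IsPiecewisePolyDist q (-1) 1 t d ∧ x = tvDist p q}

noncomputable def samples (p : Measure ℝ) (m : ℕ) : Measure (Fin m → ℝ) :=
  Measure.pi fun _ => p


/-! ### Rademacher averages of finite families of vectors -/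

/-- The sign attached to a Boolean. -/
def boolSign (b : Bool) : ℝ := if b then 1 else -1

theorem sum_exp_boolSign_le {m : ℕ} (l : ℝ) (v : Fin m → ℝ) (hv : ∀ j, |v j| ≤ 1) :
    ∑ s : Fin m → Bool, Real.exp (l * ∑ j, boolSign (s j) * v j)
      ≤ 2 ^ m * Real.exp (l ^ 2 * m / 2) := by
  have key : ∑ s : Fin m → Bool, Real.exp (l * ∑ j, boolSign (s j) * v j)
      = ∏ j, ∑ b : Bool, Real.exp (l * (boolSign b * v j)) := by
    rw [Finset.prod_univ_sum, Fintype.piFinset_univ]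
    refine Finset.sum_congr rfl fun s _ => ?_
    rw [Finset.mul_sum, Real.exp_sum]
  rw [key]
  have hfac : ∀ j, ∑ b : Bool, Real.exp (l * (boolSign b * v j)) ≤ 2 * Real.exp (l ^ 2 / 2) := by
    intro j
    have h1 : ∑ b : Bool, Real.exp (l * (boolSign b * v j)) = 2 * Real.cosh (l * v j) := by
      simp [boolSign, Real.cosh_eq]; ring
    rw [h1]
    have h2 := Real.cosh_le_exp_half_sq (l * v j)
    have h3 : Real.exp ((l * v j) ^ 2 / 2) ≤ Real.exp (l ^ 2 / 2) := by
      apply Real.exp_le_exp.2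
      have : (v j) ^ 2 ≤ 1 := (sq_le_one_iff_abs_le_one _).2 (hv j)
      nlinarith [sq_nonneg l]
    linarith
  calc _ ≤ ∏ _j : Fin m, (2 * Real.exp (l ^ 2 / 2)) :=
        Finset.prod_le_prod (fun j _ => Finset.sum_nonneg fun b _ => (Real.exp_pos _).le)
          fun j _ => hfac j
    _ = 2 ^ m * Real.exp (l ^ 2 * m / 2) := by
        rw [Finset.prod_const, mul_pow, ← Real.exp_nat_mul]
        simp only [Finset.card_univ, Fintype.card_fin]
        congr 2; ring

/-- **Massart's finite class lemma**. -/
theorem sum_iSup_abs_boolSign_le {ι : Type*} [Nonempty ι] {m N : ℕ} (w : ι → Fin m → ℝ)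
    (V : Finset (Fin m → ℝ)) (hVN : V.card ≤ N) (hwV : ∀ i, w i ∈ V)
    (hw : ∀ i j, |w i j| ≤ 1) {l : ℝ} (hl : 0 < l) :
    ∑ s : Fin m → Bool, ⨆ i, |∑ j, boolSign (s j) * w i j|
      ≤ 2 ^ m * ((Real.log (2 * N) + l ^ 2 * m / 2) / l) := by
  classical
  set U : Finset (Fin m → ℝ) := V.filter fun v => ∀ j, |v j| ≤ 1
  have hwU : ∀ i, w i ∈ U := fun i => Finset.mem_filter.2 ⟨hwV i, hw i⟩
  have hUN : (U.card : ℝ) ≤ N := by exact_mod_cast (Finset.card_filter_le _ _).trans hVN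
  have hUpos : 0 < (U.card : ℝ) := by
    exact_mod_cast Finset.card_pos.2 ⟨_, hwU (Classical.arbitrary ι)⟩
  have hNpos : (0 : ℝ) < N := hUpos.trans_le hUN
  set M : ℝ := 2 * N * Real.exp (l ^ 2 * m / 2) with hM
  have hMpos : 0 < M := by positivity
  have hlogM : Real.log M = Real.log (2 * N) + l ^ 2 * m / 2 := by
    rw [hM, Real.log_mul (by positivity) (Real.exp_pos _).ne', Real.log_exp]
  let E : (Fin m → Bool) → (Fin m → ℝ) → ℝ := fun s v =>
    Real.exp (l * ∑ j, boolSign (s j) * v j) + Real.exp ((-l) * ∑ j, boolSign (s j) * v j)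
  have hEpos : ∀ s v, 0 ≤ E s v := fun s v => by positivity
  have hpt : ∀ s : Fin m → Bool, l * ⨆ i, |∑ j, boolSign (s j) * w i j|
      ≤ Real.log M + (∑ v ∈ U, E s v) / M - 1 := by
    intro s
    rw [← le_div_iff₀' hl]
    refine ciSup_le fun i => ?_
    rw [le_div_iff₀' hl]
    set x := ∑ j, boolSign (s j) * w i j with hx
    have h1 : Real.exp (l * |x|) ≤ ∑ v ∈ U, E s v := by
      refine le_trans ?_ (Finset.single_le_sum (fun v _ => hEpos s v) (hwU i))
      change _ ≤ Real.exp (l * x) + Real.exp ((-l) * x)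
      rcases abs_cases x with ⟨h, _⟩ | ⟨h, _⟩
      · rw [h]; linarith [Real.exp_pos (-l * x)]
      · rw [h, mul_neg, ← neg_mul]; linarith [Real.exp_pos (l * x)]
    have h2 := Real.add_one_le_exp (l * |x| - Real.log M)
    rw [Real.exp_sub, Real.exp_log hMpos] at h2
    have h3 := div_le_div_of_nonneg_right h1 hMpos.le
    linarith
  have hsumE : ∑ s, ∑ v ∈ U, E s v ≤ 2 ^ m * M := by
    rw [Finset.sum_comm]
    calc _ ≤ ∑ v ∈ U, 2 * (2 ^ m * Real.exp (l ^ 2 * m / 2)) := by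
          refine Finset.sum_le_sum fun v hv => ?_
          have hv' := (Finset.mem_filter.1 hv).2
          have a := sum_exp_boolSign_le l v hv'
          have b := sum_exp_boolSign_le (-l) v hv'
          rw [neg_sq] at b
          rw [Finset.sum_add_distrib]
          linarith
      _ = U.card * (2 * (2 ^ m * Real.exp (l ^ 2 * m / 2))) := by simp
      _ ≤ N * (2 * (2 ^ m * Real.exp (l ^ 2 * m / 2))) := by gcongr
      _ = 2 ^ m * M := by rw [hM]; ring
  have htot : l * ∑ s : Fin m → Bool, ⨆ i, |∑ j, boolSign (s j) * w i j|
      ≤ 2 ^ m * Real.log M := by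
    rw [Finset.mul_sum]
    refine (Finset.sum_le_sum fun s _ => hpt s).trans ?_
    rw [Finset.sum_sub_distrib, Finset.sum_add_distrib, ← Finset.sum_div]
    have := div_le_div_of_nonneg_right hsumE hMpos.le
    rw [mul_div_assoc, div_self hMpos.ne'] at this
    simp only [Finset.sum_const, Finset.card_univ, Fintype.card_fun, Fintype.card_bool,
      Fintype.card_fin, nsmul_eq_mul, Nat.cast_pow, Nat.cast_ofNat]
    linarith
  rw [← mul_div_assoc, le_div_iff₀' hl, ← hlogM]
  exact htot

/-! ### Symmetrization -/

theorem integral_iSup_deviation_le {α ι : Type*} [MeasurableSpace α] [Countable ι] [Nonempty ι]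
    (p : Measure α) [IsProbabilityMeasure p] {m N : ℕ} (g : ι → α → ℝ)
    (hgm : ∀ i, Measurable (g i)) (hg0 : ∀ i x, 0 ≤ g i x) (hg1 : ∀ i x, g i x ≤ 1)
    (hpat : ∀ z : Fin m → α × α, ∃ V : Finset (Fin m → ℝ), V.card ≤ N ∧
      ∀ i, (fun j => g i (z j).1 - g i (z j).2) ∈ V) {l : ℝ} (hl : 0 < l) :
    ∫ s, ⨆ i, |∑ j, (g i (s j) - ∫ x, g i x ∂p)| ∂(Measure.pi fun _ : Fin m => p)
      ≤ (Real.log (2 * N) + l ^ 2 * m / 2) / l := by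
  set P := Measure.pi fun _ : Fin m => p with hP
  set Q := Measure.pi fun _ : Fin m => p.prod p with hQ
  have hint : ∀ i, Integrable (g i) p := fun i =>
    Integrable.of_bound (hgm i).aestronglyMeasurable 1
      (ae_of_all _ fun x => by rw [Real.norm_eq_abs, abs_of_nonneg (hg0 i x)]; exact hg1 i x)
  have hdiff : ∀ i x y, |g i x - g i y| ≤ 1 := fun i x y =>
    abs_le.2 ⟨by linarith [hg0 i x, hg1 i y], by linarith [hg0 i y, hg1 i x]⟩
  have hI0 : ∀ i, 0 ≤ ∫ x, g i x ∂p := fun i => integral_nonneg (hg0 i)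
  have hI1 : ∀ i, ∫ x, g i x ∂p ≤ 1 := fun i => by
    simpa using integral_mono (hint i) (integrable_const (1 : ℝ)) (hg1 i)
  have hsum : ∀ a : Fin m → ℝ, (∀ j, |a j| ≤ 1) → |∑ j, a j| ≤ m := fun a ha => by
    refine (Finset.abs_sum_le_sum_abs _ _).trans ((Finset.sum_le_sum fun j _ => ha j).trans ?_)
    simp
  -- The two-sample statistic.
  let F : (Fin m → α) × (Fin m → α) → ℝ := fun s => ⨆ i, |∑ j, (g i (s.1 j) - g i (s.2 j))|
  have hFbdd : ∀ s : (Fin m → α) × (Fin m → α),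
      BddAbove (range fun i => |∑ j, (g i (s.1 j) - g i (s.2 j))|) := fun s =>
    ⟨m, by rintro _ ⟨i, rfl⟩; exact hsum _ fun j => hdiff _ _ _⟩
  have hFm : Measurable F := by
    refine Measurable.iSup fun i => ?_
    have := hgm i
    fun_prop
  have hF0 : ∀ s, 0 ≤ F s := fun s => Real.iSup_nonneg fun i => abs_nonneg _
  have hF1 : ∀ s, F s ≤ m := fun s => ciSup_le fun i => hsum _ fun j => hdiff _ _ _
  have hFint : ∀ (μ : Measure ((Fin m → α) × (Fin m → α))) [IsFiniteMeasure μ],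
      Integrable F μ := fun μ _ =>
    Integrable.of_bound hFm.aestronglyMeasurable m
      (ae_of_all _ fun x => by rw [Real.norm_eq_abs, abs_of_nonneg (hF0 x)]; exact hF1 x)
  have hmarg : ∀ (i : ι) (j : Fin m), ∫ s, g i (s j) ∂P = ∫ x, g i x ∂p := fun i j =>
    integral_comp_eval (μ := fun _ : Fin m => p) (hgm i).aestronglyMeasurable
  have hmint : ∀ (i : ι) (j : Fin m), Integrable (fun s : Fin m → α => g i (s j)) P := fun i j =>
    Integrable.of_bound ((hgm i).comp (measurable_pi_apply j)).aestronglyMeasurable 1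
      (ae_of_all _ fun x => by rw [Real.norm_eq_abs, abs_of_nonneg (hg0 i _)]; exact hg1 i _)
  have hghost : ∀ s : Fin m → α, ⨆ i, |∑ j, (g i (s j) - ∫ x, g i x ∂p)|
      ≤ ∫ s', F (s, s') ∂P := by
    intro s
    refine ciSup_le fun i => ?_
    have hFs : Integrable (fun s' => F (s, s')) P :=
      Integrable.of_bound (hFm.comp measurable_prodMk_left).aestronglyMeasurable m
        (ae_of_all _ fun x => by
          rw [Real.norm_eq_abs, abs_of_nonneg (hF0 _)]; exact hF1 _)
    have hd : ∀ j, Integrable (fun s' : Fin m → α => g i (s j) - g i (s' j)) P := fun j =>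
      (integrable_const _).sub (hmint i j)
    have e : ∑ j, (g i (s j) - ∫ x, g i x ∂p) = ∫ s', ∑ j, (g i (s j) - g i (s' j)) ∂P := by
      rw [integral_finsetSum _ fun j _ => hd j]
      refine Finset.sum_congr rfl fun j _ => ?_
      rw [integral_sub (integrable_const _) (hmint i j), hmarg]
      simp
    rw [e]
    refine abs_integral_le_integral_abs.trans (integral_mono ?_ hFs fun s' => ?_)
    · exact (integrable_finsetSum _ fun j _ => hd j).abs
    · exact le_ciSup (hFbdd (s, s')) i
  have hstep1 : ∫ s, ⨆ i, |∑ j, (g i (s j) - ∫ x, g i x ∂p)| ∂P ≤ ∫ s, F s ∂(P.prod P) := by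
    rw [integral_prod _ (hFint _)]
    refine integral_mono ?_ (hFint (P.prod P)).integral_prod_left hghost
    refine Integrable.of_bound (Measurable.aestronglyMeasurable ?_) m (ae_of_all _ fun s => ?_)
    · refine Measurable.iSup fun i => ?_
      have := hgm i
      fun_prop
    · rw [Real.norm_eq_abs, abs_of_nonneg (Real.iSup_nonneg fun i => abs_nonneg _)]
      refine ciSup_le fun i => hsum _ fun j => abs_le.2 ⟨?_, ?_⟩
      · linarith [hg0 i (s j), hI1 i]
      · linarith [hg1 i (s j), hI0 i]
  have hiso := measurePreserving_arrowProdEquivProdArrow α α (Fin m) (fun _ => p) (fun _ => p)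
  let G : (Fin m → α × α) → ℝ := fun z => ⨆ i, |∑ j, (g i (z j).1 - g i (z j).2)|
  have hGm : Measurable G := by
    refine Measurable.iSup fun i => ?_
    have := hgm i
    fun_prop
  have hG0 : ∀ z, 0 ≤ G z := fun s => Real.iSup_nonneg fun i => abs_nonneg _
  have hG1 : ∀ z, G z ≤ m := fun s => ciSup_le fun i => hsum _ fun j => hdiff _ _ _
  have hstep2 : ∫ s, F s ∂(P.prod P) = ∫ z, G z ∂Q :=
    (hiso.integral_comp' (g := F)).symm
  -- Swapping the coordinates of some of the pairs preserves the measure.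
  let sw : (Fin m → Bool) → (Fin m → α × α) → (Fin m → α × α) := fun s z j =>
    (if s j then id else Prod.swap) (z j)
  have hsw : ∀ s, MeasurePreserving (sw s) Q Q := fun s =>
    measurePreserving_pi _ _ fun j => by
      by_cases h : s j
      · simpa [h] using MeasurePreserving.id (p.prod p)
      · simpa [h] using Measure.measurePreserving_swap (μ := p) (ν := p)
  have hswG : ∀ s z, G (sw s z) = ⨆ i, |∑ j, boolSign (s j) * (g i (z j).1 - g i (z j).2)| := by
    intro s z
    refine iSup_congr fun i => ?_
    congr 1
    refine Finset.sum_congr rfl fun j _ => ?_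
    by_cases h : s j <;> simp [sw, h, boolSign]
  have hswint : ∀ s, Integrable (fun z => G (sw s z)) Q := fun s =>
    Integrable.of_bound (hGm.comp (hsw s).measurable).aestronglyMeasurable m
      (ae_of_all _ fun x => by rw [Real.norm_eq_abs, abs_of_nonneg (hG0 _)]; exact hG1 _)
  have hinv : ∀ s, ∫ z, G (sw s z) ∂Q = ∫ z, G z ∂Q := fun s => by
    rw [← integral_map (hsw s).measurable.aemeasurable hGm.aestronglyMeasurable, (hsw s).map_eq]
  have havg : (2 : ℝ) ^ m * ∫ z, G z ∂Q = ∫ z, ∑ s, G (sw s z) ∂Q := by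
    rw [integral_finsetSum _ fun s _ => hswint s]
    simp [hinv]
  have hbound : ∫ z, ∑ s, G (sw s z) ∂Q
      ≤ 2 ^ m * ((Real.log (2 * N) + l ^ 2 * m / 2) / l) := by
    have h : ∀ z, ∑ s, G (sw s z) ≤ 2 ^ m * ((Real.log (2 * N) + l ^ 2 * m / 2) / l) := by
      intro z
      obtain ⟨V, hV, hV'⟩ := hpat z
      simp_rw [hswG]
      exact sum_iSup_abs_boolSign_le (fun i j => g i (z j).1 - g i (z j).2) V hV hV'
        (fun i j => hdiff _ _ _) hl
    simpa using integral_mono (integrable_finsetSum _ fun s _ => hswint s)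
      (integrable_const (μ := Q) _) h
  rw [← havg] at hbound
  rw [hstep2] at hstep1
  exact hstep1.trans (le_of_mul_le_mul_left hbound (by positivity))

/-! ### Traces of set families of bounded VC dimension -/

open Classical in
/-- The traces of a family of sets on a finite set. -/
noncomputable def traces {α ι : Type*} (S : ι → Set α) (Z : Finset α) : Finset (Finset α) :=
  Z.powerset.filter fun B => ∃ i, B = Z.filter (· ∈ S i)

open Classical in
theorem card_traces_le {α ι : Type*} (S : ι → Set α) {D n : ℕ} (hn : 1 ≤ n)
    (hD : ∀ Y : Finset α, (∀ B ⊆ Y, ∃ i, ∀ y ∈ Y, y ∈ S i ↔ y ∈ B) → Y.card ≤ D)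
    (Z : Finset α) (hZ : Z.card ≤ n) : (traces S Z).card ≤ (D + 1) * n ^ D := by
  have hsub : (traces S Z).shatterer ⊆
      (Finset.range (D + 1)).biUnion fun k => Z.powersetCard k := by
    intro Y hY
    rw [Finset.mem_shatterer] at hY
    have hYZ : Y ⊆ Z := by
      obtain ⟨u, hu, hYu⟩ := hY.exists_superset
      exact hYu.trans (Finset.mem_powerset.1 (Finset.mem_filter.1 hu).1)
    have hYD : Y.card ≤ D := by
      refine hD Y fun B hB => ?_
      obtain ⟨u, hu, huB⟩ := hY hB
      obtain ⟨i, rfl⟩ := (Finset.mem_filter.1 hu).2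
      refine ⟨i, fun y hy => ?_⟩
      rw [← huB]
      simp [hy, hYZ hy]
    simp only [Finset.mem_biUnion, Finset.mem_range, Finset.mem_powersetCard]
    exact ⟨Y.card, by omega, hYZ, rfl⟩
  calc (traces S Z).card ≤ (traces S Z).shatterer.card := Finset.card_le_card_shatterer _
    _ ≤ _ := Finset.card_le_card hsub
    _ ≤ ∑ k ∈ Finset.range (D + 1), (Z.powersetCard k).card := Finset.card_biUnion_le
    _ ≤ ∑ k ∈ Finset.range (D + 1), n ^ D := by
        refine Finset.sum_le_sum fun k hk => ?_
        rw [Finset.card_powersetCard]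
        calc Z.card.choose k ≤ Z.card ^ k := Nat.choose_le_pow _ _
          _ ≤ n ^ k := Nat.pow_le_pow_left hZ k
          _ ≤ n ^ D := Nat.pow_le_pow_right hn (by simpa [Nat.lt_succ_iff] using hk)
    _ = (D + 1) * n ^ D := by simp

open Classical in
theorem exists_finset_pattern {α ι : Type*} (S : ι → Set α) {D m : ℕ} (hm : 1 ≤ m)
    (hD : ∀ Y : Finset α, (∀ B ⊆ Y, ∃ i, ∀ y ∈ Y, y ∈ S i ↔ y ∈ B) → Y.card ≤ D)
    (z : Fin m → α × α) : ∃ V : Finset (Fin m → ℝ), V.card ≤ (D + 1) * (2 * m) ^ D ∧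
      ∀ i, (fun j => (S i).indicator (1 : α → ℝ) (z j).1
        - (S i).indicator (1 : α → ℝ) (z j).2) ∈ V := by
  set Z : Finset α := Finset.univ.image (fun j => (z j).1) ∪ Finset.univ.image fun j => (z j).2
    with hZ
  have hZc : Z.card ≤ 2 * m := by
    refine (Finset.card_union_le _ _).trans ?_
    have h1 := Finset.card_image_le (s := (Finset.univ : Finset (Fin m))) (f := fun j => (z j).1)
    have h2 := Finset.card_image_le (s := (Finset.univ : Finset (Fin m))) (f := fun j => (z j).2)
    rw [Finset.card_univ, Fintype.card_fin] at h1 h2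
    omega
  have hz1 : ∀ j, (z j).1 ∈ Z := fun j => by simp [hZ]
  have hz2 : ∀ j, (z j).2 ∈ Z := fun j => by simp [hZ]
  refine ⟨(traces S Z).image fun (B : Finset α) j => (B : Set α).indicator (1 : α → ℝ) (z j).1
    - (B : Set α).indicator (1 : α → ℝ) (z j).2,
    Finset.card_image_le.trans (card_traces_le S (by omega) hD Z hZc), fun i => ?_⟩
  refine Finset.mem_image.2 ⟨Z.filter (· ∈ S i), ?_, ?_⟩
  · exact Finset.mem_filter.2 ⟨Finset.mem_powerset.2 (Finset.filter_subset _ _), i, rfl⟩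
  · funext j
    simp [Set.indicator_apply, hz1 j, hz2 j]

/-- Uniform deviation bound for a countable set family of bounded VC dimension. -/
theorem integral_iSup_empirical_le {α ι : Type*} [MeasurableSpace α] [Countable ι] [Nonempty ι]
    (p : Measure α) [IsProbabilityMeasure p] (S : ι → Set α) (hS : ∀ i, MeasurableSet (S i))
    {D m : ℕ} (hm : 1 ≤ m)
    (hD : ∀ Y : Finset α, (∀ B ⊆ Y, ∃ i, ∀ y ∈ Y, y ∈ S i ↔ y ∈ B) → Y.card ≤ D)
    {l : ℝ} (hl : 0 < l) :
    ∫ s, ⨆ i, |∑ j, ((S i).indicator (1 : α → ℝ) (s j) - p.real (S i))|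
        ∂(Measure.pi fun _ : Fin m => p)
      ≤ (Real.log (2 * ((D + 1) * (2 * m) ^ D : ℕ)) + l ^ 2 * m / 2) / l := by
  have h := integral_iSup_deviation_le p (m := m) (N := (D + 1) * (2 * m) ^ D)
    (fun i => (S i).indicator (1 : α → ℝ))
    (fun i => measurable_one.indicator (hS i))
    (fun i x => Set.indicator_nonneg (fun _ _ => zero_le_one) x)
    (fun i x => Set.indicator_le_self' (fun _ _ => zero_le_one) x)
    (fun z => exists_finset_pattern S hm hD z) hl
  simpa only [integral_indicator_one (hS _)] using h

/-! ### Sign changes of piecewise polynomials -/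

/-- A polynomial of degree at most `d` cannot alternate between positive and nonpositive values
along `d + 2` increasing points. -/
theorem not_alternating_polynomial {d : ℕ} (P : Polynomial ℝ) (hP : P.natDegree ≤ d)
    (y : ℕ → ℝ) (hy : ∀ r ≤ d, y r < y (r + 1)) (r₀ : ℕ)
    (hpos : ∀ r ≤ d + 1, 0 < P.eval (y r) ↔ Even (r₀ + r)) : False := by
  have hshift : ∃ δ : ℝ, 0 < δ ∧ ∀ r ≤ d + 1, Even (r₀ + r) → δ < P.eval (y r) := by
    have hfin : ∀ n : ℕ, ∃ δ : ℝ, 0 < δ ∧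
        ∀ r < n, 0 < P.eval (y r) → δ < P.eval (y r) := by
      intro n
      induction n with
      | zero => exact ⟨1, one_pos, fun r hr => absurd hr (Nat.not_lt_zero _)⟩
      | succ n ih =>
        obtain ⟨δ, hδ, h⟩ := ih
        by_cases hn : 0 < P.eval (y n)
        · refine ⟨min δ (P.eval (y n) / 2), by positivity, fun r hr hr' => ?_⟩
          rcases Nat.lt_succ_iff_lt_or_eq.1 hr with hr | rfl
          · exact (min_le_left _ _).trans_lt (h r hr hr')
          · exact (min_le_right _ _).trans_lt (by linarith)
        · refine ⟨δ, hδ, fun r hr hr' => ?_⟩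
          rcases Nat.lt_succ_iff_lt_or_eq.1 hr with hr | rfl
          · exact h r hr hr'
          · exact absurd hr' hn
    obtain ⟨δ, hδ, h⟩ := hfin (d + 2)
    exact ⟨δ, hδ, fun r hr he => h r (by omega) ((hpos r hr).2 he)⟩
  obtain ⟨δ, hδ, hδ'⟩ := hshift
  set Q : Polynomial ℝ := P - Polynomial.C δ with hQ
  have hQd : Q.natDegree ≤ d := by rw [hQ, Polynomial.natDegree_sub_C]; exact hP
  have hQe : ∀ x, Q.eval x = P.eval x - δ := fun x => by simp [hQ]
  have hQpos : ∀ r ≤ d + 1, Even (r₀ + r) → 0 < Q.eval (y r) := fun r hr he => by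
    rw [hQe]; linarith [hδ' r hr he]
  have hQneg : ∀ r ≤ d + 1, ¬ Even (r₀ + r) → Q.eval (y r) < 0 := fun r hr he => by
    rw [hQe]; linarith [not_lt.1 (mt (hpos r hr).1 he)]
  have hQ0 : Q ≠ 0 := by
    intro h0
    by_cases he : Even (r₀ + 0)
    · simpa [h0] using hQpos 0 (by omega) he
    · simpa [h0] using hQneg 0 (by omega) he
  have hroot : ∀ r : Fin (d + 1), ∃ x ∈ Ioo (y r) (y (r + 1)), Q.eval x = 0 := by
    intro r
    have hr : (r : ℕ) ≤ d := by omega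
    have hc : ContinuousOn (fun x => Q.eval x) (Icc (y r) (y (r + 1))) :=
      Q.continuous.continuousOn
    by_cases he : Even (r₀ + (r : ℕ))
    · have he' : ¬ Even (r₀ + ((r : ℕ) + 1)) := by
        rw [← add_assoc, Nat.even_add_one]; simpa using he
      exact intermediate_value_Ioo' (hy r hr).le hc
        ⟨hQneg _ (by omega) he', hQpos _ (by omega) he⟩
    · have he' : Even (r₀ + ((r : ℕ) + 1)) := by
        rw [← add_assoc, Nat.even_add_one]; exact he
      exact intermediate_value_Ioo (hy r hr).le hc
        ⟨hQneg _ (by omega) he, hQpos _ (by omega) he'⟩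
  choose x hx hx0 using hroot
  have hymono : ∀ a b : ℕ, a ≤ b → b ≤ d + 1 → y a ≤ y b := by
    intro a b hab
    induction b, hab using Nat.le_induction with
    | base => exact fun _ => le_rfl
    | succ n hn ih => exact fun h => (ih (by omega)).trans (hy n (by omega)).le
  have hxmono : StrictMono x := by
    intro a b hab
    have hab' : (a : ℕ) < b := hab
    have := hymono (a + 1) b (by omega) (by omega)
    linarith [(hx a).2, (hx b).1]
  have hcard : d + 1 ≤ Q.roots.toFinset.card := by
    have : (Finset.univ.image x).card = d + 1 := by
      rw [Finset.card_image_of_injective _ hxmono.injective]; simp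
    rw [← this]
    refine Finset.card_le_card fun a ha => ?_
    obtain ⟨r, _, rfl⟩ := Finset.mem_image.1 ha
    rw [Multiset.mem_toFinset, Polynomial.mem_roots hQ0]
    exact hx0 r
  have := (hcard.trans (Multiset.toFinset_card_le _)).trans (Polynomial.card_roots' Q)
  omega

/-- The points at which one function exceeds another on `[a, b)`. -/
def yatracosSet (a b : ℝ) (f g : ℝ → ℝ) : Set ℝ := {x ∈ Ico a b | g x < f x}

theorem exists_piece_index {t : ℕ} {a b : ℝ} (x : Fin (t + 1) → ℝ) (h0 : x 0 = a)
    (hl : x (Fin.last t) = b) {y : ℝ} (hy : y ∈ Ico a b) :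
    ∃ i : Fin t, y ∈ Ico (x i.castSucc) (x i.succ) := by
  by_contra! h
  have hall : ∀ i : Fin (t + 1), x i ≤ y := by
    intro i
    induction i using Fin.induction with
    | zero => rw [h0]; exact hy.1
    | succ i ih =>
      by_contra! hlt
      exact h i ⟨ih, hlt⟩
  exact absurd (hall (Fin.last t)) (by rw [hl]; exact not_le.2 hy.2)

theorem piece_index_mono {t : ℕ} {x : Fin (t + 1) → ℝ} (hx : Monotone x) {y z : ℝ}
    (hyz : y ≤ z) {i j : Fin t} (hi : y ∈ Ico (x i.castSucc) (x i.succ))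
    (hj : z ∈ Ico (x j.castSucc) (x j.succ)) : i ≤ j := by
  by_contra! h
  have : x j.succ ≤ x i.castSucc := hx (by
    rw [Fin.le_def]; simpa using h)
  linarith [hi.1, hj.2]

/-- The Yatracos family of the piecewise polynomials with `t` pieces of degree at most `d` shatters
no set of more than `2 t (d + 1)` points. -/
theorem card_le_of_shattered {ι : Type*} {a b : ℝ} {t d : ℕ} (f : ι → ℝ → ℝ)
    (hf : ∀ i, IsPiecewisePoly a b t d (f i)) (Y : Finset ℝ)
    (hY : ∀ B ⊆ Y, ∃ ij : ι × ι, ∀ y ∈ Y, y ∈ yatracosSet a b (f ij.1) (f ij.2) ↔ y ∈ B) :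
    Y.card ≤ 2 * t * (d + 1) := by
  classical
  by_contra! hcard
  set n := Y.card with hn
  let e := Y.orderEmbOfFin hn.symm
  have heY : ∀ r, e r ∈ Y := fun r => Y.orderEmbOfFin_mem hn.symm r
  have hYsub : ∀ y ∈ Y, y ∈ Ico a b := by
    obtain ⟨ij, h⟩ := hY Y subset_rfl
    exact fun y hy => ((h y hy).2 hy).1
  obtain ⟨ij, h⟩ := hY (Y.filter fun y => ∃ r : Fin n, e r = y ∧ Even (r : ℕ))
    (Finset.filter_subset _ _)
  have halt : ∀ r : Fin n, f ij.2 (e r) < f ij.1 (e r) ↔ Even (r : ℕ) := by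
    intro r
    have h1 := h (e r) (heY r)
    simp only [yatracosSet, mem_ofPred_eq, hYsub _ (heY r), true_and, Finset.mem_filter, heY r,
      EmbeddingLike.apply_eq_iff_eq, exists_eq_left] at h1
    exact h1
  obtain ⟨x, hx0, hxl, hxm, hxP⟩ := hf ij.1
  obtain ⟨x', hx0', hxl', hxm', hxP'⟩ := hf ij.2
  choose u hu using fun r : Fin n => exists_piece_index x hx0 hxl (hYsub _ (heY r))
  choose v hv using fun r : Fin n => exists_piece_index x' hx0' hxl' (hYsub _ (heY r))
  have hum : ∀ r s : Fin n, r ≤ s → u r ≤ u s := fun r s hrs =>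
    piece_index_mono hxm (e.monotone hrs) (hu r) (hu s)
  have hvm : ∀ r s : Fin n, r ≤ s → v r ≤ v s := fun r s hrs =>
    piece_index_mono hxm' (e.monotone hrs) (hv r) (hv s)
  have hlt : ∀ k, k ≤ 2 * t → k * (d + 1) < n := fun k hk =>
    (Nat.mul_le_mul_right (d + 1) hk).trans_lt hcard
  -- Two consecutive block endpoints lie in the same piece of the common refinement.
  have hblock : ∃ k, ∃ hk : k + 1 ≤ 2 * t,
      u ⟨k * (d + 1), hlt k (by omega)⟩ = u ⟨(k + 1) * (d + 1), hlt (k + 1) hk⟩ ∧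
      v ⟨k * (d + 1), hlt k (by omega)⟩ = v ⟨(k + 1) * (d + 1), hlt (k + 1) hk⟩ := by
    by_contra! hno
    have hgrow : ∀ k, ∀ hk : k ≤ 2 * t,
        k ≤ (u ⟨k * (d + 1), hlt k hk⟩ : ℕ) + v ⟨k * (d + 1), hlt k hk⟩ := by
      intro k
      induction k with
      | zero => intro _; omega
      | succ k ih =>
        intro hk
        have h1 := ih (by omega)
        have hle : (⟨k * (d + 1), hlt k (by omega)⟩ : Fin n) ≤ ⟨(k + 1) * (d + 1), hlt (k + 1) hk⟩ :=
          Fin.mk_le_mk.2 (Nat.mul_le_mul_right _ (Nat.le_succ k))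
        have h2 := Fin.le_def.1 (hum _ _ hle)
        have h3 := Fin.le_def.1 (hvm _ _ hle)
        have h4 := hno k hk
        by_contra! h5
        exact h4 (Fin.ext (by omega)) (Fin.ext (by omega))
    have h1 := hgrow (2 * t) le_rfl
    have h2 := (u ⟨2 * t * (d + 1), hlt (2 * t) le_rfl⟩).isLt
    have h3 := (v ⟨2 * t * (d + 1), hlt (2 * t) le_rfl⟩).isLt
    omega
  obtain ⟨k, hk, hku, hkv⟩ := hblock
  set A : Fin n := ⟨k * (d + 1), hlt k (by omega)⟩ with hA
  set B : Fin n := ⟨(k + 1) * (d + 1), hlt (k + 1) hk⟩ with hB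
  obtain ⟨P, hPd, hPe⟩ := hxP (u A)
  obtain ⟨P', hPd', hPe'⟩ := hxP' (v A)
  have hBlt := hlt (k + 1) hk
  have hkd : (k + 1) * (d + 1) = k * (d + 1) + (d + 1) := by ring
  have hidx : ∀ r, r ≤ d + 1 → k * (d + 1) + r < n := fun r hr => by omega
  let y : ℕ → ℝ := fun r => if hr : r ≤ d + 1 then e ⟨k * (d + 1) + r, hidx r hr⟩ else 0
  have hye : ∀ r (hr : r ≤ d + 1), y r = e ⟨k * (d + 1) + r, hidx r hr⟩ := fun r hr => by
    simp [y, hr]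
  refine not_alternating_polynomial (d := d) (P - P')
    ((Polynomial.natDegree_sub_le _ _).trans (max_le hPd hPd')) y ?_ (k * (d + 1)) ?_
  · intro r hr
    rw [hye r (by omega), hye (r + 1) (by omega)]
    exact e.strictMono (Fin.mk_lt_mk.2 (by omega))
  · intro r hr
    rw [hye r hr]
    set R : Fin n := ⟨k * (d + 1) + r, hidx r hr⟩ with hR
    have hAR : A ≤ R := Fin.mk_le_mk.2 (by omega)
    have hRB : R ≤ B := Fin.mk_le_mk.2 (by omega)
    have huR : u R = u A := le_antisymm ((hum _ _ hRB).trans hku.ge) (hum _ _ hAR)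
    have hvR : v R = v A := le_antisymm ((hvm _ _ hRB).trans hkv.ge) (hvm _ _ hAR)
    have h1 := hPe (e R) (huR ▸ hu R)
    have h2 := hPe' (e R) (hvR ▸ hv R)
    rw [Polynomial.eval_sub, sub_pos, ← h1, ← h2]
    exact halt R

/-! ### Total variation distance -/

theorem bddAbove_range_tvDist (p q : Measure ℝ) [IsProbabilityMeasure p] [IsProbabilityMeasure q] :
    BddAbove (range fun A : {S : Set ℝ // MeasurableSet S} =>
      |(p A.1).toReal - (q A.1).toReal|) := by
  refine ⟨1, ?_⟩
  rintro _ ⟨A, rfl⟩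
  have h1 : (p A.1).toReal ≤ 1 := measureReal_le_one (μ := p)
  have h2 : (q A.1).toReal ≤ 1 := measureReal_le_one (μ := q)
  have h3 : 0 ≤ (p A.1).toReal := ENNReal.toReal_nonneg
  have h4 : 0 ≤ (q A.1).toReal := ENNReal.toReal_nonneg
  exact abs_le.2 ⟨by linarith, by linarith⟩

theorem abs_measureReal_sub_le_tvDist (p q : Measure ℝ) [IsProbabilityMeasure p]
    [IsProbabilityMeasure q] {A : Set ℝ} (hA : MeasurableSet A) :
    |p.real A - q.real A| ≤ tvDist p q :=
  le_ciSup (bddAbove_range_tvDist p q) ⟨A, hA⟩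

theorem tvDist_le {p q : Measure ℝ} {c : ℝ}
    (h : ∀ A, MeasurableSet A → |p.real A - q.real A| ≤ c) : tvDist p q ≤ c :=
  haveI : Nonempty {S : Set ℝ // MeasurableSet S} := ⟨⟨∅, MeasurableSet.empty⟩⟩
  ciSup_le fun A => h A.1 A.2

theorem tvDist_nonneg (p q : Measure ℝ) : 0 ≤ tvDist p q :=
  Real.iSup_nonneg fun _ => abs_nonneg _

theorem tvDist_le_one (p q : Measure ℝ) [IsProbabilityMeasure p] [IsProbabilityMeasure q] :
    tvDist p q ≤ 1 := by
  refine tvDist_le fun A _ => abs_le.2 ⟨?_, ?_⟩ <;>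
    linarith [measureReal_le_one (μ := p) (s := A), measureReal_le_one (μ := q) (s := A),
      measureReal_nonneg (μ := p) (s := A), measureReal_nonneg (μ := q) (s := A)]

theorem tvDist_triangle (p q r : Measure ℝ) [IsProbabilityMeasure p] [IsProbabilityMeasure q]
    [IsProbabilityMeasure r] : tvDist p r ≤ tvDist p q + tvDist q r :=
  tvDist_le fun A hA => (abs_sub_le _ (q.real A) _).trans
    (add_le_add (abs_measureReal_sub_le_tvDist p q hA) (abs_measureReal_sub_le_tvDist q r hA))

/-! ### Piecewise polynomial distributions and their densities -/

theorem IsPiecewisePoly.mono_pieces {a b : ℝ} {t t' d : ℕ} {f : ℝ → ℝ} (htt : t ≤ t')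
    (h : IsPiecewisePoly a b t d f) : IsPiecewisePoly a b t' d f := by
  obtain ⟨x, h0, hl, hm, hP⟩ := h
  refine ⟨fun i => x ⟨min i t, by omega⟩, ?_, ?_, ?_, ?_⟩
  · rw [← h0]; congr 1
  · rw [← hl]; exact congrArg x (Fin.ext (by simp [htt]))
  · intro i j hij
    exact hm (Fin.mk_le_mk.2 (min_le_min_right t (Fin.le_def.1 hij)))
  · intro i
    by_cases hi : (i : ℕ) < t
    · obtain ⟨P, hPd, hPe⟩ := hP ⟨i, hi⟩
      have e1 : (⟨min (i.castSucc : ℕ) t, by omega⟩ : Fin (t + 1)) = Fin.castSucc ⟨i, hi⟩ :=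
        Fin.ext (by simp [hi.le])
      have e2 : (⟨min (i.succ : ℕ) t, by omega⟩ : Fin (t + 1)) = Fin.succ ⟨i, hi⟩ :=
        Fin.ext (by simp [hi])
      refine ⟨P, hPd, fun y hy => hPe y ?_⟩
      rw [← e1, ← e2]
      exact hy
    · refine ⟨0, by simp, fun y hy => ?_⟩
      simp only [Fin.val_castSucc, Fin.val_succ, min_eq_right (not_lt.1 hi),
        min_eq_right ((not_lt.1 hi).trans (Nat.le_succ _)), Set.Ico_self] at hy
      exact absurd hy (Set.notMem_empty y)

theorem IsPiecewisePolyDist.mono_pieces {q : Measure ℝ} {a b : ℝ} {t t' d : ℕ} (htt : t ≤ t')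
    (h : IsPiecewisePolyDist q a b t d) : IsPiecewisePolyDist q a b t' d := by
  obtain ⟨h1, f, h2, h3, h4⟩ := h
  exact ⟨h1, f, h2, h3, h4.mono_pieces htt⟩

theorem exists_isPiecewisePolyDist {t : ℕ} (ht : 1 ≤ t) (d : ℕ) :
    ∃ q : Measure ℝ, IsPiecewisePolyDist q (-1) 1 t d := by
  refine ⟨(volume.restrict (Ico (-1 : ℝ) 1)).withDensity fun _ => ENNReal.ofReal (1 / 2),
    IsPiecewisePolyDist.mono_pieces ht ⟨⟨?_⟩, fun _ => 1 / 2, fun _ _ => by norm_num, rfl, ?_⟩⟩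
  · rw [withDensity_const, Measure.smul_apply, Measure.restrict_apply_univ, Real.volume_Ico,
      smul_eq_mul, ← ENNReal.ofReal_mul (by norm_num)]
    norm_num
  · refine ⟨![-1, 1], rfl, rfl, ?_, fun i => ⟨Polynomial.C (1 / 2), by simp, fun y _ => by simp⟩⟩
    rw [Fin.monotone_iff_le_succ]
    intro i
    fin_cases i
    norm_num

/-- `g` is an integrable density of `q` with respect to Lebesgue measure on `[a, b)`. -/
structure IsDensityOn (q : Measure ℝ) (a b : ℝ) (g : ℝ → ℝ) : Prop where
  measurable : Measurable g
  integrable : Integrable g (volume.restrict (Ico a b))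
  real_eq : ∀ A, MeasurableSet A → q.real A = ∫ y in A, g y ∂(volume.restrict (Ico a b))

theorem IsPiecewisePoly.measurable_indicator {a b : ℝ} {t d : ℕ} {f : ℝ → ℝ}
    (h : IsPiecewisePoly a b t d f) : Measurable ((Ico a b).indicator f) := by
  obtain ⟨x, h0, hl, hm, hP⟩ := h
  choose P _ hPe using hP
  have hsub : ∀ i : Fin t, Ico (x i.castSucc) (x i.succ) ⊆ Ico a b := fun i =>
    Ico_subset_Ico (h0 ▸ hm (Fin.zero_le _)) (hl ▸ hm (Fin.le_last _))
  have he : (Ico a b).indicator f = fun y => ∑ i : Fin t,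
      (Ico (x i.castSucc) (x i.succ)).indicator (fun y => (P i).eval y) y := by
    funext y
    by_cases hy : y ∈ Ico a b
    · obtain ⟨i, hi⟩ := exists_piece_index x h0 hl hy
      rw [Finset.sum_eq_single i, indicator_of_mem hy, indicator_of_mem hi, hPe i y hi]
      · intro j _ hji
        refine indicator_of_notMem (fun hj => hji ?_) _
        exact le_antisymm (piece_index_mono hm le_rfl hj hi) (piece_index_mono hm le_rfl hi hj)
      · simp
    · rw [indicator_of_notMem hy, Finset.sum_eq_zero]
      exact fun i _ => indicator_of_notMem (fun hi => hy (hsub i hi)) _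
  rw [he]
  exact Finset.measurable_sum _ fun i _ => (P i).continuous.measurable.indicator measurableSet_Ico

theorem IsPiecewisePolyDist.exists_density {q : Measure ℝ} {a b : ℝ} {t d : ℕ}
    (h : IsPiecewisePolyDist q a b t d) :
    ∃ g : ℝ → ℝ, IsDensityOn q a b g ∧ IsPiecewisePoly a b t d g := by
  obtain ⟨hq, f, hf0, hqf, hpp⟩ := h
  set g := (Ico a b).indicator f with hg
  have hgm : Measurable g := hpp.measurable_indicator
  have hg0 : ∀ y, 0 ≤ g y := fun y => indicator_nonneg hf0 y
  have hgf : ∀ y ∈ Ico a b, g y = f y := fun y hy => indicator_of_mem hy f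
  have hqg : q = (volume.restrict (Ico a b)).withDensity fun y => ENNReal.ofReal (g y) := by
    rw [hqf]
    refine withDensity_congr_ae ?_
    filter_upwards [ae_restrict_mem measurableSet_Ico] with y hy
    rw [hgf y hy]
  refine ⟨g, ⟨hgm, ⟨hgm.aestronglyMeasurable, ?_⟩, fun A hA => ?_⟩, ?_⟩
  · rw [hasFiniteIntegral_iff_ofReal (ae_of_all _ hg0)]
    have : q univ = 1 := measure_univ
    rw [hqg, withDensity_apply _ MeasurableSet.univ, Measure.restrict_univ] at this
    rw [this]; exact ENNReal.one_lt_top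
  · rw [integral_eq_lintegral_of_nonneg_ae (ae_of_all _ hg0) hgm.aestronglyMeasurable,
      measureReal_def, hqg, withDensity_apply _ hA]
  · obtain ⟨x, h0, hl, hm, hP⟩ := hpp
    refine ⟨x, h0, hl, hm, fun i => ?_⟩
    obtain ⟨P, hPd, hPe⟩ := hP i
    refine ⟨P, hPd, fun y hy => ?_⟩
    rw [← hPe y hy]
    exact hgf y ⟨(h0 ▸ hm (Fin.zero_le _) : a ≤ x i.castSucc).trans hy.1,
      hy.2.trans_le (hl ▸ hm (Fin.le_last _))⟩

theorem IsDensityOn.sub_eq {q q' : Measure ℝ} {a b : ℝ} {g g' : ℝ → ℝ} (h : IsDensityOn q a b g)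
    (h' : IsDensityOn q' a b g') {A : Set ℝ} (hA : MeasurableSet A) :
    q.real A - q'.real A = ∫ y in A, (g y - g' y) ∂(volume.restrict (Ico a b)) := by
  rw [integral_sub h.integrable.integrableOn h'.integrable.integrableOn, h.real_eq A hA,
    h'.real_eq A hA]

theorem IsDensityOn.tvDist_le_integral {q q' : Measure ℝ} {a b : ℝ} {g g' : ℝ → ℝ}
    (h : IsDensityOn q a b g) (h' : IsDensityOn q' a b g') :
    tvDist q q' ≤ ∫ y, |g y - g' y| ∂(volume.restrict (Ico a b)) := by
  refine tvDist_le fun A hA => ?_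
  rw [h.sub_eq h' hA]
  exact abs_integral_le_integral_abs.trans
    (setIntegral_le_integral (h.integrable.sub h'.integrable).abs (ae_of_all _ fun _ => abs_nonneg _))

theorem IsDensityOn.measurableSet_yatracosSet {q q' : Measure ℝ} {a b : ℝ} {g g' : ℝ → ℝ}
    (h : IsDensityOn q a b g) (h' : IsDensityOn q' a b g') :
    MeasurableSet (yatracosSet a b g g') :=
  measurableSet_Ico.inter (measurableSet_lt h'.measurable h.measurable)

/-- The total variation distance is attained on the Yatracos set of the densities. -/
theorem IsDensityOn.tvDist_le_yatracosSet {q q' : Measure ℝ} [IsProbabilityMeasure q]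
    [IsProbabilityMeasure q'] {a b : ℝ} {g g' : ℝ → ℝ}
    (h : IsDensityOn q a b g) (h' : IsDensityOn q' a b g') :
    tvDist q q' ≤ |q.real (yatracosSet a b g g') - q'.real (yatracosSet a b g g')| := by
  set S := yatracosSet a b g g' with hS
  have hSm : MeasurableSet S := h.measurableSet_yatracosSet h'
  have hi : Integrable (fun y => g y - g' y) (volume.restrict (Ico a b)) :=
    h.integrable.sub h'.integrable
  have key : ∀ B, MeasurableSet B → q.real B - q'.real B ≤ q.real S - q'.real S := by
    intro B hB
    rw [h.sub_eq h' hB, h.sub_eq h' hSm]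
    calc _ ≤ ∫ y in B, max (g y - g' y) 0 ∂(volume.restrict (Ico a b)) :=
          integral_mono hi.integrableOn hi.pos_part.integrableOn fun y => le_max_left _ _
      _ ≤ ∫ y, max (g y - g' y) 0 ∂(volume.restrict (Ico a b)) :=
          setIntegral_le_integral hi.pos_part (ae_of_all _ fun y => le_max_right _ _)
      _ = ∫ y, S.indicator (fun y => g y - g' y) y ∂(volume.restrict (Ico a b)) := by
          refine integral_congr_ae ?_
          filter_upwards [ae_restrict_mem measurableSet_Ico] with y hy
          by_cases hlt : g' y < g y
          · rw [indicator_of_mem (show y ∈ S from ⟨hy, hlt⟩), max_eq_left (by linarith)]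
          · rw [indicator_of_notMem (fun hyS : y ∈ S => hlt hyS.2), max_eq_right (by linarith)]
      _ = _ := integral_indicator hSm
  refine tvDist_le fun B hB => ?_
  refine le_trans (abs_le'.2 ⟨key B hB, ?_⟩) (le_abs_self _)
  have h1 := key Bᶜ hB.compl
  rw [probReal_compl_eq_one_sub hB, probReal_compl_eq_one_sub hB] at h1
  linarith

theorem exists_dense_seq_isPiecewisePolyDist {t : ℕ} (ht : 1 ≤ t) (d : ℕ) :
    ∃ q : ℕ → Measure ℝ, (∀ n, IsPiecewisePolyDist (q n) (-1) 1 t d) ∧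
      ∀ r, IsPiecewisePolyDist r (-1) 1 t d → ∀ δ > 0, ∃ n, tvDist r (q n) ≤ δ := by
  let X := {q : Measure ℝ // IsPiecewisePolyDist q (-1) 1 t d}
  choose g hg _ using fun q : X => q.2.exists_density
  let F : X → Lp ℝ 1 (volume.restrict (Ico (-1 : ℝ) 1)) := fun q =>
    (hg q).integrable.toL1 (g q)
  have : Fact ((1 : ℝ≥0∞) ≠ ∞) := ⟨ENNReal.one_ne_top⟩
  obtain ⟨q₀, hq₀⟩ := exists_isPiecewisePolyDist ht d
  have : Nonempty (range F) := ⟨⟨F ⟨q₀, hq₀⟩, mem_range_self _⟩⟩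
  choose u hu using fun n => (TopologicalSpace.denseSeq (range F) n).2
  refine ⟨fun n => (u n).1, fun n => (u n).2, fun r hr δ hδ => ?_⟩
  obtain ⟨n, hn⟩ := (TopologicalSpace.denseRange_denseSeq (range F)).exists_dist_lt
    ⟨F ⟨r, hr⟩, mem_range_self _⟩ hδ
  refine ⟨n, ((hg ⟨r, hr⟩).tvDist_le_integral (hg (u n))).trans ?_⟩
  rw [Subtype.dist_eq, ← hu n, L1.dist_eq_integral_dist] at hn
  refine le_trans (le_of_eq (integral_congr_ae ?_)) hn.le
  filter_upwards [(hg ⟨r, hr⟩).integrable.coeFn_toL1, (hg (u n)).integrable.coeFn_toL1]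
    with y h1 h2
  rw [h1, h2, Real.dist_eq]

/-! ### The minimum distance estimator -/

/-- A measurable estimator that nearly minimizes the empirical Yatracos distance. -/
theorem exists_minimum_distance_estimator (q : ℕ → Measure ℝ) [∀ n, IsProbabilityMeasure (q n)]
    (S : ℕ × ℕ → Set ℝ) (hS : ∀ i, MeasurableSet (S i))
    (hdist : ∀ n k, tvDist (q n) (q k) ≤ |(q n).real (S (n, k)) - (q k).real (S (n, k))|)
    {m : ℕ} (hm : 1 ≤ m) {ε : ℝ} (hε : 0 < ε) :
    ∃ A : (Fin m → ℝ) → Measure ℝ, Measurable A ∧ (∀ s, ∃ n, A s = q n) ∧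
      ∀ (p : Measure ℝ) [IsProbabilityMeasure p] (s : Fin m → ℝ) (n : ℕ),
        tvDist p (A s) ≤ 3 * tvDist p (q n) +
          2 * ((⨆ i, |∑ j, ((S i).indicator (1 : ℝ → ℝ) (s j) - p.real (S i))|) / m) + ε := by
  classical
  have hm0 : (0 : ℝ) < m := by exact_mod_cast hm
  let e : ℕ × ℕ → (Fin m → ℝ) → ℝ := fun i s =>
    (∑ j, (S i).indicator (1 : ℝ → ℝ) (s j)) / m
  have hind0 : ∀ i x, 0 ≤ (S i).indicator (1 : ℝ → ℝ) x := fun i x =>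
    indicator_nonneg (fun _ _ => zero_le_one) x
  have hind1 : ∀ i x, (S i).indicator (1 : ℝ → ℝ) x ≤ 1 := fun i x =>
    indicator_le_self' (fun _ _ => zero_le_one) x
  have he0 : ∀ i s, 0 ≤ e i s := fun i s =>
    div_nonneg (Finset.sum_nonneg fun j _ => hind0 _ _) hm0.le
  have he1 : ∀ i s, e i s ≤ 1 := fun i s => by
    rw [div_le_one hm0]
    refine (Finset.sum_le_sum fun j _ => hind1 _ _).trans ?_
    simp
  have hem : ∀ i, Measurable (e i) := fun i => by
    have : Measurable ((S i).indicator (1 : ℝ → ℝ)) := measurable_one.indicator (hS i)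
    fun_prop
  let W : ℕ → (Fin m → ℝ) → ℝ := fun n s => ⨆ i, |(q n).real (S i) - e i s|
  have hbdd : ∀ (r : Measure ℝ) [IsProbabilityMeasure r] s,
      BddAbove (range fun i => |r.real (S i) - e i s|) := fun r _ s => by
    refine ⟨1, ?_⟩
    rintro _ ⟨i, rfl⟩
    refine abs_le.2 ⟨?_, ?_⟩ <;>
      linarith [measureReal_le_one (μ := r) (s := S i),
        measureReal_nonneg (μ := r) (s := S i), he0 i s, he1 i s]
  have hW0 : ∀ n s, 0 ≤ W n s := fun n s => Real.iSup_nonneg fun _ => abs_nonneg _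
  have hWm : ∀ n, Measurable (W n) := fun n => Measurable.iSup fun i => by
    have := hem i
    fun_prop
  have hWb : ∀ s, BddBelow (range fun n => W n s) := fun s =>
    ⟨0, by rintro _ ⟨n, rfl⟩; exact hW0 n s⟩
  have hex : ∀ s, ∃ n, W n s ≤ (⨅ k, W k s) + ε := fun s => by
    obtain ⟨n, hn⟩ := exists_lt_of_ciInf_lt (lt_add_of_pos_right (⨅ k, W k s) hε)
    exact ⟨n, hn.le⟩
  have hidx : Measurable fun s => Nat.find (hex s) :=
    measurable_find hex fun n =>
      measurableSet_le (hWm n) ((Measurable.iInf hWm).add_const ε)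
  refine ⟨fun s => q (Nat.find (hex s)), measurable_from_nat.comp hidx, fun s => ⟨_, rfl⟩, ?_⟩
  intro p _ s n
  set N := Nat.find (hex s)
  set Δ := (⨆ i, |∑ j, ((S i).indicator (1 : ℝ → ℝ) (s j) - p.real (S i))|) / (m : ℝ) with hΔ
  have hN : W N s ≤ W n s + ε :=
    (Nat.find_spec (hex s)).trans (add_le_add_left (ciInf_le (hWb s) n) ε)
  have hdev : ∀ i, |p.real (S i) - e i s| ≤ Δ := by
    have habs : ∀ i, |p.real (S i) - e i s|
        = |∑ j, ((S i).indicator (1 : ℝ → ℝ) (s j) - p.real (S i))| / m := by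
      intro i
      rw [abs_sub_comm, ← Nat.abs_cast m, ← abs_div]
      congr 1
      rw [Finset.sum_sub_distrib]
      simp only [e, Finset.sum_const, Finset.card_univ, Fintype.card_fin, nsmul_eq_mul]
      field_simp
    intro i
    rw [habs]
    refine div_le_div_of_nonneg_right ?_ hm0.le
    refine le_ciSup (f := fun i => |∑ j, ((S i).indicator (1 : ℝ → ℝ) (s j) - p.real (S i))|)
      ?_ i
    obtain ⟨c, hc⟩ := hbdd p s
    refine ⟨c * m, ?_⟩
    rintro _ ⟨i, rfl⟩
    have := hc (mem_range_self i)
    simp only [habs] at this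
    exact (div_le_iff₀ hm0).1 this
  have hWn : W n s ≤ tvDist p (q n) + Δ := ciSup_le fun i => by
    refine (abs_sub_le _ (p.real (S i)) _).trans (add_le_add ?_ (hdev i))
    rw [abs_sub_comm]
    exact abs_measureReal_sub_le_tvDist p (q n) (hS i)
  have hle : ∀ k i, |(q k).real (S i) - e i s| ≤ W k s := fun k i => le_ciSup (hbdd (q k) s) i
  have hnN : tvDist (q n) (q N) ≤ W n s + W N s := by
    refine (hdist n N).trans ((abs_sub_le _ (e (n, N) s) _).trans (add_le_add (hle _ _) ?_))
    rw [abs_sub_comm]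
    exact hle _ _
  have htri := tvDist_triangle p (q n) (q N)
  linarith

theorem log_growth_le {B ε : ℝ} {D m : ℕ} (hD : (D : ℝ) = 2 * B) (hB : 1 ≤ B) (hε : 0 < ε)
    (hε3 : ε < 1 / 3) (hm : 20 * D * Real.log (B / ε) / ε ^ 2 ≤ m)
    (hm' : (m : ℝ) ≤ 20 * D * Real.log (B / ε) / ε ^ 2 + 1) :
    1 ≤ Real.log (B / ε) ∧
      Real.log (2 * ((D + 1) * (2 * m) ^ D : ℕ)) ≤ m * ε ^ 2 := by
  set L := Real.log (B / ε) with hL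
  have hx3 : 3 ≤ B / ε := by rw [le_div_iff₀ hε]; linarith
  have hL1 : 1 ≤ L := by
    rw [hL, Real.le_log_iff_exp_le (by positivity)]
    linarith [Real.exp_one_lt_d9]
  refine ⟨hL1, ?_⟩
  have hD1 : (1 : ℝ) ≤ D := by rw [hD]; linarith
  have hDL : 1 ≤ D * L := one_le_mul_of_one_le_of_one_le hD1 hL1
  have hε2 : 0 < ε ^ 2 := by positivity
  have hq1 : 1 ≤ D * L / ε ^ 2 := by
    rw [le_div_iff₀ hε2]
    nlinarith
  have hq : 20 * D * L / ε ^ 2 = 20 * (D * L / ε ^ 2) := by ring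
  have hmpos : (0 : ℝ) < m := lt_of_lt_of_le (by rw [hq]; linarith) hm
  have hLx : L ≤ B / ε := (Real.log_le_sub_one_of_pos (by positivity)).trans (by linarith)
  have h2m : 2 * (m : ℝ) ≤ 84 * (B / ε) ^ 3 := by
    have h1 : 2 * (m : ℝ) ≤ 42 * (D * L / ε ^ 2) := by rw [hq] at hm'; linarith
    have h2 : D * L / ε ^ 2 ≤ 2 * (B / ε) ^ 3 := by
      have h3 : D * L / ε ^ 2 ≤ 2 * B * (B / ε) / ε ^ 2 := by
        rw [hD]; gcongr
      have h4 : 2 * B * (B / ε) / ε ^ 2 = 2 * (B ^ 2 / ε ^ 3) := by field_simp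
      have h5 : B ^ 2 / ε ^ 3 ≤ B ^ 3 / ε ^ 3 := by
        gcongr
        · norm_num
      rw [div_pow]
      linarith
    linarith
  have hlog2m : Real.log (2 * m) ≤ 5 + 3 * L := by
    refine (Real.log_le_log (by positivity) h2m).trans ?_
    rw [Real.log_mul (by norm_num) (by positivity), Real.log_pow]
    have : Real.log 84 ≤ 5 := by
      rw [Real.log_le_iff_le_exp (by norm_num)]
      have h : Real.exp 5 = Real.exp 1 ^ 5 := by rw [← Real.exp_nat_mul]; norm_num
      rw [h]
      calc (84 : ℝ) ≤ 2.7 ^ 5 := by norm_num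
        _ ≤ _ := by
          gcongr
          linarith [Real.exp_one_gt_d9]
    push_cast
    linarith
  have hsplit : Real.log (2 * ((D + 1) * (2 * m) ^ D : ℕ))
      = Real.log 2 + Real.log (D + 1) + D * Real.log (2 * m) := by
    push_cast
    rw [Real.log_mul (by norm_num) (by positivity), Real.log_mul (by positivity) (by positivity),
      Real.log_pow]
    ring
  have hl2 : Real.log 2 ≤ 1 := by linarith [Real.log_two_lt_d9]
  have hlD : Real.log (D + 1) ≤ D := by
    linarith [Real.log_le_sub_one_of_pos (show (0 : ℝ) < D + 1 by positivity)]
  have hfin : 20 * D * L ≤ m * ε ^ 2 := (div_le_iff₀ hε2).1 hm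
  rw [hsplit]
  have hDlog : D * Real.log (2 * m) ≤ D * (5 + 3 * L) :=
    mul_le_mul_of_nonneg_left hlog2m (by positivity)
  nlinarith

/-- Agnostic learning of piecewise polynomials from a prescribed number of samples. -/
theorem exists_estimator_of_growth_le {T d m : ℕ} (hT : 1 ≤ T) (hm : 1 ≤ m) {ε : ℝ} (hε : 0 < ε)
    (hgrowth : Real.log (2 * ((2 * T * (d + 1) + 1) * (2 * m) ^ (2 * T * (d + 1)) : ℕ))
      ≤ m * ε ^ 2) :
    ∃ A : (Fin m → ℝ) → Measure ℝ, Measurable A ∧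
      (∀ s, IsPiecewisePolyDist (A s) (-1) 1 T d) ∧
      ∀ (p : Measure ℝ) [IsProbabilityMeasure p], (9 / 10 : ℝ≥0∞) ≤ samples p m
        {s | tvDist p (A s) ≤ 3 * optTD p T d + 37 * ε} := by
  obtain ⟨q, hq, hdense⟩ := exists_dense_seq_isPiecewisePolyDist hT d
  choose g hg hgp using fun n => (hq n).exists_density
  have : ∀ n, IsProbabilityMeasure (q n) := fun n => (hq n).1
  let S : ℕ × ℕ → Set ℝ := fun i => yatracosSet (-1) 1 (g i.1) (g i.2)
  have hS : ∀ i, MeasurableSet (S i) := fun i => (hg i.1).measurableSet_yatracosSet (hg i.2)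
  obtain ⟨A, hAm, hAq, hA⟩ := exists_minimum_distance_estimator q S hS
    (fun n k => (hg n).tvDist_le_yatracosSet (hg k)) hm hε
  refine ⟨A, hAm, fun s => ?_, fun p _ => ?_⟩
  · obtain ⟨n, hn⟩ := hAq s
    rw [hn]; exact hq n
  have hm0 : (0 : ℝ) < m := by exact_mod_cast hm
  let X : (Fin m → ℝ) → ℝ := fun s =>
    ⨆ i, |∑ j, ((S i).indicator (1 : ℝ → ℝ) (s j) - p.real (S i))|
  have hX0 : ∀ s, 0 ≤ X s := fun s => Real.iSup_nonneg fun _ => abs_nonneg _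
  have hXm : Measurable X := Measurable.iSup fun i => by
    have : Measurable ((S i).indicator (1 : ℝ → ℝ)) := measurable_one.indicator (hS i)
    fun_prop
  have hX1 : ∀ s, X s ≤ m := fun s => ciSup_le fun i => by
    refine (Finset.abs_sum_le_sum_abs _ _).trans
      ((Finset.sum_le_sum fun j _ => (?_ : _ ≤ (1 : ℝ))).trans (by simp))
    have h0 : 0 ≤ (S i).indicator (1 : ℝ → ℝ) (s j) := indicator_nonneg (fun _ _ => zero_le_one) _
    have h1 : (S i).indicator (1 : ℝ → ℝ) (s j) ≤ 1 :=
      indicator_le_self' (fun _ _ => zero_le_one) _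
    refine abs_le.2 ⟨?_, ?_⟩ <;>
      linarith [measureReal_le_one (μ := p) (s := S i), measureReal_nonneg (μ := p) (s := S i)]
  have hXint : Integrable X (samples p m) := by
    unfold samples
    exact Integrable.of_bound hXm.aestronglyMeasurable m (ae_of_all _ fun s => by
      rw [Real.norm_eq_abs, abs_of_nonneg (hX0 s)]; exact hX1 s)
  have hEX : ∫ s, X s ∂(samples p m) ≤ 3 / 2 * (m * ε) := by
    refine (integral_iSup_empirical_le p S hS hm
      (fun Y hY => card_le_of_shattered g hgp Y hY) hε).trans ?_
    rw [div_le_iff₀ hε]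
    linarith
  have : IsProbabilityMeasure (samples p m) := by unfold samples; infer_instance
  have hmarkov := mul_meas_ge_le_integral_of_nonneg (ae_of_all _ hX0) hXint (15 * (m * ε))
  have hbad : (samples p m).real {s | 15 * (m * ε) ≤ X s} ≤ 1 / 10 := by
    have hpos : 0 < 15 * (m * ε) := by positivity
    refine le_of_mul_le_mul_left ((hmarkov.trans hEX).trans (le_of_eq ?_)) hpos
    ring
  have hgood : 9 / 10 ≤ (samples p m).real {s | 15 * (m * ε) ≤ X s}ᶜ := by
    rw [probReal_compl_eq_one_sub (measurableSet_le measurable_const hXm)]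
    linarith
  have hgood' : (9 / 10 : ℝ≥0∞) ≤ samples p m {s | 15 * (m * ε) ≤ X s}ᶜ := by
    have := (ENNReal.ofReal_le_iff_le_toReal (measure_ne_top _ _)).2 hgood
    rwa [ENNReal.ofReal_div_of_pos (by norm_num), ENNReal.ofReal_ofNat, ENNReal.ofReal_ofNat]
      at this
  refine hgood'.trans (measure_mono fun s hs => ?_)
  have hXs : X s / m ≤ 15 * ε := by
    have hs' : ¬ 15 * (m * ε) ≤ X s := hs
    rw [div_le_iff₀ hm0]
    linarith
  obtain ⟨q₀, hq₀⟩ := exists_isPiecewisePolyDist hT d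
  obtain ⟨_, ⟨r, hr, rfl⟩, hrlt⟩ := exists_lt_of_csInf_lt
    (s := {x : ℝ | ∃ q : Measure ℝ, IsPiecewisePolyDist q (-1) 1 T d ∧ x = tvDist p q})
    ⟨_, q₀, hq₀, rfl⟩ (lt_add_of_pos_right (optTD p T d) hε)
  obtain ⟨n, hn⟩ := hdense r hr ε hε
  have := hr.1
  have htri := tvDist_triangle p r (q n)
  have hAs := hA p s n
  change tvDist p (A s) ≤ 3 * optTD p T d + 37 * ε
  change tvDist p (A s) ≤ 3 * tvDist p (q n) + 2 * (X s / m) + ε at hAs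
  linarith

theorem optTD_nonneg (p : Measure ℝ) (t d : ℕ) : 0 ≤ optTD p t d :=
  Real.sInf_nonneg (by rintro _ ⟨q, _, rfl⟩; exact tvDist_nonneg p q)

/-- Main result (Theorem 2 / thm:main-detail, sample-complexity part):
learning k-mixtures of (τ,t)-piecewise degree-d distributions over [-1,1). -/
theorem main_learning_piecewise_poly_mixtures :
    ∃ C c : ℝ, 0 < C ∧ 0 < c ∧
      ∀ k t d : ℕ, 1 ≤ k → 1 ≤ t →
      ∀ ε τ : ℝ, 0 < ε → ε < 1 → 0 ≤ τ →
        ∃ (m : ℕ) (A : (Fin m → ℝ) → Measure ℝ),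
          (m : ℝ) ≤ C * ((d : ℝ) + 1) * k * t *
              (Real.log (((d : ℝ) + 1) * k * t / ε)) ^ c / ε ^ 2 ∧
          Measurable A ∧
          ∀ p : Measure ℝ, IsProbabilityMeasure p → p (Set.Ico (-1 : ℝ) 1) = 1 →
            (∃ (μ : Fin k → ℝ≥0∞) (pc : Fin k → Measure ℝ),
              (∑ j, μ j) = 1 ∧ p = ∑ j, μ j • pc j ∧
              ∀ j, IsProbabilityMeasure (pc j) ∧ pc j (Set.Ico (-1 : ℝ) 1) = 1 ∧
                ∃ q : Measure ℝ, IsPiecewisePolyDist q (-1) 1 t d ∧ tvDist (pc j) q ≤ τ) →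
            (9 / 10 : ℝ≥0∞) ≤ samples p m
              {s | IsPiecewisePolyDist (A s) (-1) 1 (2 * k * t - 1) d ∧
                   tvDist p (A s) ≤ 4 * optTD p (k * t) d * (1 + ε) + C * ε} := by
  refine ⟨80, 1, by norm_num, one_pos, fun k t d hk ht ε τ hε hε1 _ => ?_⟩
  have hT : 1 ≤ k * t := Nat.mul_pos hk ht
  have hTle : k * t ≤ 2 * k * t - 1 := by rw [mul_assoc]; omega
  have hB : (1 : ℝ) ≤ ((d : ℝ) + 1) * k * t := by
    exact_mod_cast Nat.mul_pos (Nat.mul_pos d.succ_pos hk) ht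
  set B : ℝ := ((d : ℝ) + 1) * k * t with hBdef
  have hCB : (80 : ℝ) * ((d : ℝ) + 1) * k * t = 80 * B := by rw [hBdef]; ring
  simp only [Real.rpow_one, hCB]
  by_cases hlarge : 1 / 80 ≤ ε
  · obtain ⟨q, hq⟩ := exists_isPiecewisePolyDist (hT.trans hTle) d
    have hL : 0 ≤ Real.log (B / ε) :=
      Real.log_nonneg (by rw [le_div_iff₀ hε]; linarith)
    refine ⟨0, fun _ => q, by rw [Nat.cast_zero]; positivity, measurable_const, fun p hp _ _ => ?_⟩
    have := hq.1
    have hopt := optTD_nonneg p (k * t) d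
    have hall : {s : Fin 0 → ℝ | IsPiecewisePolyDist q (-1) 1 (2 * k * t - 1) d ∧
        tvDist p q ≤ 4 * optTD p (k * t) d * (1 + ε) + 80 * ε} = univ :=
      eq_univ_of_forall fun _ => ⟨hq, by
        have : 0 ≤ 4 * optTD p (k * t) d * (1 + ε) := by positivity
        linarith [tvDist_le_one p q]⟩
    rw [hall, samples, measure_univ]
    exact ENNReal.div_le_of_le_mul (by norm_num)
  · push Not at hlarge
    set D : ℕ := 2 * (k * t) * (d + 1) with hDdef
    have hD : (D : ℝ) = 2 * B := by rw [hDdef, hBdef]; push_cast; ring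
    set L := Real.log (B / ε) with hLdef
    have hL0 : 0 ≤ L := Real.log_nonneg (by rw [le_div_iff₀ hε]; linarith)
    have hceil := Nat.le_ceil (20 * D * L / ε ^ 2)
    have hceil' := (Nat.ceil_lt_add_one (a := 20 * D * L / ε ^ 2) (by positivity)).le
    set m : ℕ := ⌈20 * D * L / ε ^ 2⌉₊ with hmdef
    obtain ⟨hL1, hgrowth⟩ := log_growth_le hD hB hε (by linarith) hceil hceil'
    have hBL : 1 ≤ B * L / ε ^ 2 := by
      rw [le_div_iff₀ (by positivity)]
      nlinarith [one_le_mul_of_one_le_of_one_le hB hL1]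
    have hval : 20 * D * L / ε ^ 2 = 40 * (B * L / ε ^ 2) := by rw [hD]; ring
    have hm : 1 ≤ m := by
      have : (1 : ℝ) ≤ m := by rw [hval] at hceil; linarith
      exact_mod_cast this
    obtain ⟨A, hAm, hApp, hA⟩ := exists_estimator_of_growth_le hT hm hε hgrowth
    refine ⟨m, A, ?_, hAm, fun p hp _ _ => (hA p).trans (measure_mono fun s hs => ⟨?_, ?_⟩)⟩
    · rw [hval] at hceil'
      have : 80 * B * L / ε ^ 2 = 80 * (B * L / ε ^ 2) := by ring
      linarith
    · exact (hApp s).mono_pieces hTle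
    · have hs' : tvDist p (A s) ≤ 3 * optTD p (k * t) d + 37 * ε := hs
      have hopt := optTD_nonneg p (k * t) d
      nlinarith [mul_nonneg hopt hε.le]
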